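/- Let 1 < p < ∞ and let W : ℝ^d → M_n(ℂ) be a matrix weight with reducing operators V_I and dual reducing operators V_I'. Then the quantity sup over cubes I of (1/|I|)∫_I ((1/|I|)∫_I ‖W^{1/p}(x) W^{−1/p}(t)‖^{p'} dt)^{p/p'} dx is finite if and only if sup over cubes I of ‖V_I V_I'‖ is finite, and the first quantity is comparable to (sup_I ‖V_I V_I'‖)^p with constants depending only on p, n. -/

import Mathlib

open MeasureTheory ENNReal
open scoped ComplexOrder

noncomputable section

/-! ## Basic linear-algebra notation -/

/-- The operator norm of an `n × n` complex matrix, viewed as an operator on the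
Euclidean space `ℂⁿ`. -/
def matNorm {n : ℕ} (M : Matrix (Fin n) (Fin n) ℂ) : ℝ :=
  ‖Matrix.toEuclideanCLM (𝕜 := ℂ) (n := Fin n) M‖

/-- A matrix applied to a vector of `ℂⁿ` (with its Euclidean norm). -/
def mApp {n : ℕ} (M : Matrix (Fin n) (Fin n) ℂ) (v : EuclideanSpace ℂ (Fin n)) :
    EuclideanSpace ℂ (Fin n) :=
  Matrix.toEuclideanCLM (𝕜 := ℂ) (n := Fin n) M v


/-- Entrywise measurability of a matrix-valued function. -/
def MatMeasurable {d n : ℕ} (W : (Fin d → ℝ) → Matrix (Fin n) (Fin n) ℂ) : Prop :=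
  ∀ i j, Measurable fun x => W x i j

/-! ## Dyadic cubes and Haar functions -/

/-- A dyadic cube in `ℝ^d`, with side length `2^k` and lower-left corner `(m i * 2^k)_i`. -/
structure DCube (d : ℕ) where
  k : ℤ
  m : Fin d → ℤ

namespace DCube

variable {d : ℕ}

/-- The (half-open) cube in `ℝ^d` determined by a dyadic cube. -/
def set (I : DCube d) : Set (Fin d → ℝ) :=
  {x | ∀ i, (I.m i : ℝ) * 2 ^ I.k ≤ x i ∧ x i < ((I.m i : ℝ) + 1) * 2 ^ I.k}

/-- The volume `|I| = (2^k)^d` of a dyadic cube. -/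
def vol (I : DCube d) : ℝ := ((2 : ℝ) ^ I.k) ^ d

/-- The lower-left corner of a dyadic cube. -/
def corner (I : DCube d) : Fin d → ℝ := fun i => (I.m i : ℝ) * 2 ^ I.k

/-- The side length of a dyadic cube. -/
def side (I : DCube d) : ℝ := (2 : ℝ) ^ I.k

end DCube

/-- One-dimensional Haar functions on the dyadic interval `[m·2^k, (m+1)·2^k)`:
`haar1D true` is the non-cancellative `|I|^{-1/2} χ_I`, while `haar1D false` is
`|I|^{-1/2} (χ_{I_ℓ} - χ_{I_r})`. -/
def haar1D (ε : Bool) (k mm : ℤ) (t : ℝ) : ℝ :=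
  if ε then
    Set.indicator {s : ℝ | (mm : ℝ) * 2 ^ k ≤ s ∧ s < ((mm : ℝ) + 1) * 2 ^ k}
      (fun _ => ((2 : ℝ) ^ k) ^ (-(1 / 2 : ℝ))) t
  else
    Set.indicator {s : ℝ | (mm : ℝ) * 2 ^ k ≤ s ∧ s < (mm : ℝ) * 2 ^ k + 2 ^ (k - 1)}
      (fun _ => ((2 : ℝ) ^ k) ^ (-(1 / 2 : ℝ))) t -
    Set.indicator {s : ℝ | (mm : ℝ) * 2 ^ k + 2 ^ (k - 1) ≤ s ∧ s < ((mm : ℝ) + 1) * 2 ^ k}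
      (fun _ => ((2 : ℝ) ^ k) ^ (-(1 / 2 : ℝ))) t

/-- The signature set `𝒮 = {0,1}^d \ {(1,…,1)}` indexing the cancellative Haar functions. -/
def Sfin (d : ℕ) : Finset (Fin d → Bool) := Finset.univ.erase (fun _ => true)

/-- The Haar function `h_I^ε = ∏ i, h_{I_i}^{ε_i}` associated to a dyadic cube `I ⊂ ℝ^d`
and a signature `ε ∈ {0,1}^d`. -/
def haarFn {d : ℕ} (I : DCube d) (ε : Fin d → Bool) (x : Fin d → ℝ) : ℝ :=
  ∏ i, haar1D (ε i) I.k (I.m i) (x i)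

/-- The (vector of) Haar coefficients `f_I^ε = ∫ f h_I^ε` of a `ℂⁿ`-valued function. -/
def haarCoef {d n : ℕ} (f : (Fin d → ℝ) → EuclideanSpace ℂ (Fin n)) (I : DCube d)
    (ε : Fin d → Bool) : EuclideanSpace ℂ (Fin n) :=
  ∫ x, haarFn I ε x • f x

/-! ## Matrix `A_p` weights and reducing operators -/

/-- The (closed, axis-parallel) cube with corner `c` and side length `r`. -/
def cubeSet {d : ℕ} (c : Fin d → ℝ) (r : ℝ) : Set (Fin d → ℝ) :=
  {x | ∀ i, c i ≤ x i ∧ x i ≤ c i + r}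

/-- The matrix `A_p` characteristic `‖W‖_{A_p}` of a matrix weight `W`, expressed in terms of
`W1p = W^{1/p}` (so that `W^{-1/p} = (W1p)⁻¹`):
`sup_I (1/|I|) ∫_I ((1/|I|) ∫_I ‖W^{1/p}(x) W^{-1/p}(t)‖^{p'} dt)^{p/p'} dx`,
the supremum being over all cubes `I ⊂ ℝ^d`.  Here `p' = p/(p-1)` and `p/p' = p - 1`. -/
def apNorm {d n : ℕ} (p : ℝ) (W1p : (Fin d → ℝ) → Matrix (Fin n) (Fin n) ℂ) : ℝ≥0∞ :=
  ⨆ (c : Fin d → ℝ) (r : ℝ) (_ : 0 < r),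
    (ENNReal.ofReal (r ^ d))⁻¹ *
      ∫⁻ x in cubeSet c r,
        ((ENNReal.ofReal (r ^ d))⁻¹ *
            ∫⁻ t in cubeSet c r,
              ENNReal.ofReal (matNorm (W1p x * (W1p t)⁻¹)) ^ (p / (p - 1))) ^ (p - 1)

/-- The `L^q` average `(|I|^{-1} ∫_I ‖A(x) e‖^q dx)^{1/q}` over a dyadic cube. -/
def redAvgD {d n : ℕ} (q : ℝ) (A : (Fin d → ℝ) → Matrix (Fin n) (Fin n) ℂ) (I : DCube d)
    (e : EuclideanSpace ℂ (Fin n)) : ℝ≥0∞ :=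
  ((ENNReal.ofReal I.vol)⁻¹ * ∫⁻ x in I.set, ENNReal.ofReal ‖mApp (A x) e‖ ^ q) ^ (1 / q)

/-- `V` is a family of reducing operators for the weight `W = (W1p)^p` (indexed by dyadic
cubes), with comparability constants `c₁, c₂`:  each `V I` is positive definite and
`|V_I e| ≈ (|I|^{-1} ∫_I |W^{1/p}(x) e|^p dx)^{1/p}`. -/
def IsReducing {d n : ℕ} (p c₁ c₂ : ℝ) (W1p : (Fin d → ℝ) → Matrix (Fin n) (Fin n) ℂ)
    (V : DCube d → Matrix (Fin n) (Fin n) ℂ) : Prop :=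
  ∀ I : DCube d, (V I).PosDef ∧ ∀ e : EuclideanSpace ℂ (Fin n),
    ENNReal.ofReal c₁ * redAvgD p W1p I e ≤ ENNReal.ofReal ‖mApp (V I) e‖ ∧
    ENNReal.ofReal ‖mApp (V I) e‖ ≤ ENNReal.ofReal c₂ * redAvgD p W1p I e

/-- `V'` is a family of dual reducing operators for the weight `W = (W1p)^p`:
`|V_I' e| ≈ (|I|^{-1} ∫_I |W^{-1/p}(x) e|^{p'} dx)^{1/p'}` with `p' = p/(p-1)`. -/
def IsDualReducing {d n : ℕ} (p c₁ c₂ : ℝ) (W1p : (Fin d → ℝ) → Matrix (Fin n) (Fin n) ℂ)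
    (V' : DCube d → Matrix (Fin n) (Fin n) ℂ) : Prop :=
  ∀ I : DCube d, (V' I).PosDef ∧ ∀ e : EuclideanSpace ℂ (Fin n),
    ENNReal.ofReal c₁ * redAvgD (p / (p - 1)) (fun x => (W1p x)⁻¹) I e ≤
        ENNReal.ofReal ‖mApp (V' I) e‖ ∧
    ENNReal.ofReal ‖mApp (V' I) e‖ ≤
        ENNReal.ofReal c₂ * redAvgD (p / (p - 1)) (fun x => (W1p x)⁻¹) I e

/-- The `L^p(W)` norm `(∫ |W^{1/p}(x) f(x)|^p dx)^{1/p}` (as a value in `[0,∞]`). -/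
def wNorm {d n : ℕ} (p : ℝ) (W1p : (Fin d → ℝ) → Matrix (Fin n) (Fin n) ℂ)
    (f : (Fin d → ℝ) → EuclideanSpace ℂ (Fin n)) : ℝ≥0∞ :=
  (∫⁻ x, ENNReal.ofReal ‖mApp (W1p x) (f x)‖ ^ p) ^ (1 / p)

/-- The square-function expression
`∑_{I ∈ 𝒟} ∑_{ε ∈ 𝒮} |A_I f_I^ε|² |I|^{-1} χ_I(x)` for a family of matrices `A_I`. -/
def sqFn {d n : ℕ} (A : DCube d → Matrix (Fin n) (Fin n) ℂ)
    (f : (Fin d → ℝ) → EuclideanSpace ℂ (Fin n)) (x : Fin d → ℝ) : ℝ≥0∞ :=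
  ∑' I : DCube d, ∑ ε ∈ Sfin d,
    Set.indicator I.set
      (fun _ => ENNReal.ofReal (‖mApp (A I) (haarCoef f I ε)‖ ^ 2) / ENNReal.ofReal I.vol) x

/-! ## Stopping times -/

/-- A stopping time assigns to each dyadic cube `I` a collection `𝒥 I` of pairwise disjoint
dyadic subcubes of `I`. -/
def IsStopping {d : ℕ} (𝒥 : DCube d → Set (DCube d)) : Prop :=
  ∀ I : DCube d, (∀ J ∈ 𝒥 I, J.set ⊆ I.set) ∧
    (𝒥 I).Pairwise fun J K => Disjoint J.set K.set

/-- `ℱ(I)`: the dyadic subcubes of `I` not contained in any stopping cube `J ∈ 𝒥(I)`. -/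
def Fcol {d : ℕ} (𝒥 : DCube d → Set (DCube d)) (I : DCube d) : Set (DCube d) :=
  {J | J.set ⊆ I.set ∧ ∀ K ∈ 𝒥 I, ¬J.set ⊆ K.set}

/-- A stopping time is admissible if `I ∈ ℱ(I)` for every `I`. -/
def Admissible {d : ℕ} (𝒥 : DCube d → Set (DCube d)) : Prop :=
  ∀ I : DCube d, I ∈ Fcol 𝒥 I

/-- The iterated stopping collections: `𝒥^0(I) = {I}` and
`𝒥^{j+1}(I) = ⋃_{J ∈ 𝒥^j(I)} 𝒥(J)`. -/
def JIter {d : ℕ} (𝒥 : DCube d → Set (DCube d)) : ℕ → DCube d → Set (DCube d)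
  | 0, I => {I}
  | j + 1, I => ⋃ J ∈ JIter 𝒥 j I, 𝒥 J

/-- A stopping time is decaying with constant `c` if
`∑_{J ∈ 𝒥(I)} |J| ≤ c |I|` for every `I`. -/
def Decaying {d : ℕ} (c : ℝ) (𝒥 : DCube d → Set (DCube d)) : Prop :=
  ∀ I : DCube d,
    ∑' J : 𝒥 I, ENNReal.ofReal (J : DCube d).vol ≤ ENNReal.ofReal c * ENNReal.ofReal I.vol

/-- `ℱ^j = ℱ^j(I₀) = ⋃_{J ∈ 𝒥^{j-1}(I₀)} ℱ(J)` (intended for `j ≥ 1`). -/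
def Fj {d : ℕ} (𝒥 : DCube d → Set (DCube d)) (I₀ : DCube d) (j : ℕ) : Set (DCube d) :=
  ⋃ J ∈ JIter 𝒥 (j - 1) I₀, Fcol 𝒥 J

/-- The Haar projection `Δ_j f = ∑_{I ∈ ℱ^j} ∑_{ε ∈ 𝒮} f_I^ε h_I^ε`. -/
def deltaHaar {d n : ℕ} (𝒥 : DCube d → Set (DCube d)) (I₀ : DCube d) (j : ℕ)
    (f : (Fin d → ℝ) → EuclideanSpace ℂ (Fin n)) (x : Fin d → ℝ) :
    EuclideanSpace ℂ (Fin n) :=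
  ∑' I : Fj 𝒥 I₀ j, ∑ ε ∈ Sfin d, haarFn (I : DCube d) ε x • haarCoef f (I : DCube d) ε

/-! ## Constant Haar multipliers -/

/-- `∑_{I ∈ S} ∑_{ε ∈ 𝒮} V_I^{-1} f_I^ε h_I^ε(x)`. -/
def projInv {d n : ℕ} (V : DCube d → Matrix (Fin n) (Fin n) ℂ) (S : Set (DCube d))
    (f : (Fin d → ℝ) → EuclideanSpace ℂ (Fin n)) (x : Fin d → ℝ) :
    EuclideanSpace ℂ (Fin n) :=
  ∑' I : S, ∑ ε ∈ Sfin d,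
    haarFn (I : DCube d) ε x • mApp ((V (I : DCube d))⁻¹) (haarCoef f (I : DCube d) ε)

/-- A function has finite Haar expansion if it is a finite sum of Haar functions. -/
def FiniteHaar {d n : ℕ} (f : (Fin d → ℝ) → EuclideanSpace ℂ (Fin n)) : Prop :=
  ∃ F : Finset (DCube d × (Fin d → Bool)),
    ∀ x, f x = ∑ q ∈ F, haarFn q.1 q.2 x • haarCoef f q.1 q.2

/-! ## The weighted stopping time -/

/-- The stopping condition `‖V_J V_I^{-1}‖^p > λ₁` or `‖V_J^{-1} V_I‖^{p'} > λ₂`. -/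
def stopBad {d n : ℕ} (p l₁ l₂ : ℝ) (V : DCube d → Matrix (Fin n) (Fin n) ℂ)
    (J I : DCube d) : Prop :=
  l₁ < matNorm (V J * (V I)⁻¹) ^ p ∨ l₂ < matNorm ((V J)⁻¹ * V I) ^ (p / (p - 1))

/-- The stopping time `𝒥(I)` = maximal dyadic subcubes `J ⊆ I` satisfying `stopBad`. -/
def stopST {d n : ℕ} (p l₁ l₂ : ℝ) (V : DCube d → Matrix (Fin n) (Fin n) ℂ)
    (I : DCube d) : Set (DCube d) :=
  {J | J.set ⊆ I.set ∧ stopBad p l₁ l₂ V J I ∧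
    ∀ K : DCube d, K.set ⊆ I.set → stopBad p l₁ l₂ V K I → J.set ⊆ K.set → K = J}


/-- The `L^q` average `(|I|^{-1} ∫_I ‖A(x) e‖^q dx)^{1/q}` over the cube with corner `c`
and side `r`. -/
def redAvgC {d n : ℕ} (q : ℝ) (A : (Fin d → ℝ) → Matrix (Fin n) (Fin n) ℂ)
    (c : Fin d → ℝ) (r : ℝ) (e : EuclideanSpace ℂ (Fin n)) : ℝ≥0∞ :=
  ((ENNReal.ofReal (r ^ d))⁻¹ * ∫⁻ x in cubeSet c r, ENNReal.ofReal ‖mApp (A x) e‖ ^ q) ^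
    (1 / q)

/-- Reducing operators `V_I` indexed by all cubes `I ⊂ ℝ^d` (corner `c`, side `r`):
`|V_I e| ≈ (|I|^{-1} ∫_I |W^{1/p}(x) e|^p)^{1/p}`. -/
def IsReducingAll {d n : ℕ} (p c₁ c₂ : ℝ)
    (W1p : (Fin d → ℝ) → Matrix (Fin n) (Fin n) ℂ)
    (V : (Fin d → ℝ) → ℝ → Matrix (Fin n) (Fin n) ℂ) : Prop :=
  ∀ (c : Fin d → ℝ) (r : ℝ), 0 < r → (V c r).PosDef ∧
    ∀ e : EuclideanSpace ℂ (Fin n),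
      ENNReal.ofReal c₁ * redAvgC p W1p c r e ≤ ENNReal.ofReal ‖mApp (V c r) e‖ ∧
      ENNReal.ofReal ‖mApp (V c r) e‖ ≤ ENNReal.ofReal c₂ * redAvgC p W1p c r e

/-- Dual reducing operators `V_I'` indexed by all cubes:
`|V_I' e| ≈ (|I|^{-1} ∫_I |W^{-1/p}(x) e|^{p'})^{1/p'}` with `p' = p/(p-1)`. -/
def IsDualReducingAll {d n : ℕ} (p c₁ c₂ : ℝ)
    (W1p : (Fin d → ℝ) → Matrix (Fin n) (Fin n) ℂ)
    (V' : (Fin d → ℝ) → ℝ → Matrix (Fin n) (Fin n) ℂ) : Prop :=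
  ∀ (c : Fin d → ℝ) (r : ℝ), 0 < r → (V' c r).PosDef ∧
    ∀ e : EuclideanSpace ℂ (Fin n),
      ENNReal.ofReal c₁ * redAvgC (p / (p - 1)) (fun x => (W1p x)⁻¹) c r e ≤
          ENNReal.ofReal ‖mApp (V' c r) e‖ ∧
      ENNReal.ofReal ‖mApp (V' c r) e‖ ≤
          ENNReal.ofReal c₂ * redAvgC (p / (p - 1)) (fun x => (W1p x)⁻¹) c r e

section MatrixNorm

variable {n : ℕ}

lemma mApp_mul (A B : Matrix (Fin n) (Fin n) ℂ) (v : EuclideanSpace ℂ (Fin n)) :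
    mApp (A * B) v = mApp A (mApp B v) := by
  simp [mApp]

/-- Reversing a product of Hermitian matrices does not change its operator norm. -/
lemma matNorm_mul_comm {A B : Matrix (Fin n) (Fin n) ℂ} (hA : A.IsHermitian)
    (hB : B.IsHermitian) : matNorm (A * B) = matNorm (B * A) := by
  have h : B * A = star (A * B) := by
    rw [star_mul, Matrix.star_eq_conjTranspose, Matrix.star_eq_conjTranspose, hA.eq, hB.eq]
  rw [h, matNorm, matNorm, map_star, ContinuousLinearMap.star_eq_adjoint,
    LinearIsometryEquiv.norm_map]

lemma norm_mApp_single_le (M : Matrix (Fin n) (Fin n) ℂ) (j : Fin n) :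
    ‖mApp M (EuclideanSpace.single j 1)‖ ≤ matNorm M := by
  simpa [mApp, matNorm] using (Matrix.toEuclideanCLM (𝕜 := ℂ) (n := Fin n) M).le_opNorm
    (EuclideanSpace.single j 1)

lemma matNorm_le_sum (M : Matrix (Fin n) (Fin n) ℂ) :
    matNorm M ≤ ∑ j, ‖mApp M (EuclideanSpace.single j 1)‖ := by
  refine ContinuousLinearMap.opNorm_le_bound _ (by positivity) fun v => ?_
  have hv : v = ∑ j, v j • EuclideanSpace.single j (1 : ℂ) := by
    simpa using ((EuclideanSpace.basisFun (Fin n) ℂ).sum_repr v).symm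
  conv_lhs => rw [hv]
  rw [map_sum, Finset.sum_mul]
  refine (norm_sum_le _ _).trans (Finset.sum_le_sum fun j _ => ?_)
  rw [map_smul, norm_smul, mul_comm]
  exact mul_le_mul_of_nonneg_left (PiLp.norm_apply_le v j) (norm_nonneg _)

lemma ENNReal.rpow_sum_le_card_rpow_mul_sum {ι : Type*} [Fintype ι] (f : ι → ℝ≥0∞) {s : ℝ}
    (hs : 0 < s) : (∑ j, f j) ^ s ≤ (Fintype.card ι : ℝ≥0∞) ^ s * ∑ j, f j ^ s := by
  have h : ∑ j, f j ≤ Fintype.card ι * (∑ j, f j ^ s) ^ s⁻¹ := by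
    refine (Finset.sum_le_card_nsmul _ _ ((∑ j, f j ^ s) ^ s⁻¹) fun j _ => ?_).trans
      (by simp)
    rw [ENNReal.le_rpow_inv_iff hs]
    exact Finset.single_le_sum (f := fun j => f j ^ s) (fun _ _ => zero_le) (Finset.mem_univ j)
  refine (ENNReal.rpow_le_rpow h hs.le).trans ?_
  rw [ENNReal.mul_rpow_of_nonneg _ _ hs.le, ← ENNReal.rpow_mul, inv_mul_cancel₀ hs.ne',
    ENNReal.rpow_one]

lemma ofReal_matNorm_rpow_le (M : Matrix (Fin n) (Fin n) ℂ) {s : ℝ} (hs : 0 < s) :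
    ENNReal.ofReal (matNorm M) ^ s ≤
      (n : ℝ≥0∞) ^ s * ∑ j, ENNReal.ofReal ‖mApp M (EuclideanSpace.single j 1)‖ ^ s := by
  have h := ENNReal.rpow_sum_le_card_rpow_mul_sum
    (fun j => ENNReal.ofReal ‖mApp M (EuclideanSpace.single j 1)‖) hs
  rw [Fintype.card_fin] at h
  refine le_trans (ENNReal.rpow_le_rpow ?_ hs.le) h
  rw [← ENNReal.ofReal_sum_of_nonneg fun _ _ => norm_nonneg _]
  exact ENNReal.ofReal_le_ofReal (matNorm_le_sum M)

lemma ofReal_norm_mApp_single_rpow_le (M : Matrix (Fin n) (Fin n) ℂ) (j : Fin n) {s : ℝ}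
    (hs : 0 < s) :
    ENNReal.ofReal ‖mApp M (EuclideanSpace.single j 1)‖ ^ s ≤ ENNReal.ofReal (matNorm M) ^ s :=
  ENNReal.rpow_le_rpow (ENNReal.ofReal_le_ofReal (norm_mApp_single_le M j)) hs.le

end MatrixNorm

namespace MatMeasurable

variable {d n : ℕ} {W : (Fin d → ℝ) → Matrix (Fin n) (Fin n) ℂ}

lemma det (hW : MatMeasurable W) : Measurable fun x => (W x).det := by
  simp only [Matrix.det_apply']
  exact Finset.measurable_fun_sum _ fun σ _ =>
    (Finset.measurable_fun_prod _ fun i _ => hW (σ i) i).const_mul _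

lemma inv (hW : MatMeasurable W) : MatMeasurable fun x => (W x)⁻¹ := by
  intro i j
  simp only [Matrix.inv_def, Ring.inverse_eq_inv', Matrix.smul_apply, Matrix.adjugate_apply,
    smul_eq_mul]
  refine hW.det.inv.mul (det fun k l => ?_)
  by_cases hk : k = j
  · subst hk
    simp
  · simpa [Matrix.updateRow_ne hk] using hW k l

lemma norm_mApp (hW : MatMeasurable W) (v : EuclideanSpace ℂ (Fin n)) :
    Measurable fun x => ‖mApp (W x) v‖ := by
  have h : ∀ x i, mApp (W x) v i = ∑ j, W x i j * v j := by
    intro x i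
    simp [mApp, Matrix.mulVec, dotProduct]
  simp only [EuclideanSpace.norm_eq, h]
  refine (Finset.measurable_fun_sum _ fun i _ => ?_).sqrt
  exact (Finset.measurable_fun_sum _ fun j _ => (hW i j).mul_const _).norm.pow_const 2

end MatMeasurable

section Averages

variable {d n : ℕ} {s c₁ c₂ : ℝ} {A : (Fin d → ℝ) → Matrix (Fin n) (Fin n) ℂ}
  {c : Fin d → ℝ} {r : ℝ} {V : Matrix (Fin n) (Fin n) ℂ}

lemma redAvgC_rpow (hs : 0 < s) (e : EuclideanSpace ℂ (Fin n)) :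
    redAvgC s A c r e ^ s = (ENNReal.ofReal (r ^ d))⁻¹ *
      ∫⁻ x in cubeSet c r, ENNReal.ofReal ‖mApp (A x) e‖ ^ s := by
  rw [redAvgC, ← ENNReal.rpow_mul, one_div_mul_cancel hs.ne', ENNReal.rpow_one]

/-- The `L^s` average of `‖A(t) M‖` is controlled by `‖V M‖` when `V` dominates the averages
of `A`. -/
lemma average_matNorm_mul_rpow_le (hs : 0 < s) (hc₁ : 0 < c₁) (hA : MatMeasurable A)
    (hV : ∀ e, ENNReal.ofReal c₁ * redAvgC s A c r e ≤ ENNReal.ofReal ‖mApp V e‖)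
    (M : Matrix (Fin n) (Fin n) ℂ) :
    (ENNReal.ofReal (r ^ d))⁻¹ *
        ∫⁻ t in cubeSet c r, ENNReal.ofReal (matNorm (A t * M)) ^ s ≤
      (n : ℝ≥0∞) ^ s * n * (ENNReal.ofReal c₁)⁻¹ ^ s * ENNReal.ofReal (matNorm (V * M)) ^ s := by
  set C := ENNReal.ofReal c₁
  have hC : C ≠ 0 := by simpa [C] using hc₁
  have hC' : C ≠ ⊤ := ENNReal.ofReal_ne_top
  let e : Fin n → EuclideanSpace ℂ (Fin n) := fun j => EuclideanSpace.single j 1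
  have hterm (j : Fin n) : redAvgC s A c r (mApp M (e j)) ^ s ≤
      C⁻¹ ^ s * ENNReal.ofReal (matNorm (V * M)) ^ s := by
    have h : redAvgC s A c r (mApp M (e j)) ≤ C⁻¹ * ENNReal.ofReal (matNorm (V * M)) := by
      rw [← ENNReal.mul_le_iff_le_inv hC hC']
      refine (hV _).trans (ENNReal.ofReal_le_ofReal ?_)
      rw [← mApp_mul]
      exact norm_mApp_single_le _ _
    simpa [ENNReal.mul_rpow_of_nonneg _ _ hs.le] using ENNReal.rpow_le_rpow h hs.le
  calc (ENNReal.ofReal (r ^ d))⁻¹ *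
        ∫⁻ t in cubeSet c r, ENNReal.ofReal (matNorm (A t * M)) ^ s
      ≤ (ENNReal.ofReal (r ^ d))⁻¹ * ∫⁻ t in cubeSet c r,
          (n : ℝ≥0∞) ^ s * ∑ j, ENNReal.ofReal ‖mApp (A t) (mApp M (e j))‖ ^ s := by
        gcongr with t
        simpa only [mApp_mul] using ofReal_matNorm_rpow_le (A t * M) hs
    _ = (n : ℝ≥0∞) ^ s * ∑ j, redAvgC s A c r (mApp M (e j)) ^ s := by
        have hm (v : EuclideanSpace ℂ (Fin n)) :
            Measurable fun t => ENNReal.ofReal ‖mApp (A t) v‖ ^ s :=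
          (hA.norm_mApp v).ennreal_ofReal.pow_const s
        rw [lintegral_const_mul _ (Finset.measurable_fun_sum _ fun j _ => hm _),
          lintegral_finsetSum _ fun j _ => hm _, mul_left_comm, Finset.mul_sum]
        simp only [redAvgC_rpow hs]
    _ ≤ (n : ℝ≥0∞) ^ s * ∑ _j : Fin n, C⁻¹ ^ s * ENNReal.ofReal (matNorm (V * M)) ^ s := by
        gcongr with j
        exact hterm j
    _ = _ := by
        simp only [Finset.sum_const, Finset.card_univ, Fintype.card_fin, nsmul_eq_mul]
        ring

/-- `‖V M‖` is controlled by the `L^s` average of `‖A(t) M‖` when `V` is dominated by the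
averages of `A`. -/
lemma matNorm_mul_rpow_le_average (hs : 0 < s)
    (hV : ∀ e, ENNReal.ofReal ‖mApp V e‖ ≤ ENNReal.ofReal c₂ * redAvgC s A c r e)
    (M : Matrix (Fin n) (Fin n) ℂ) :
    ENNReal.ofReal (matNorm (V * M)) ^ s ≤
      (n : ℝ≥0∞) ^ s * n * ENNReal.ofReal c₂ ^ s * ((ENNReal.ofReal (r ^ d))⁻¹ *
        ∫⁻ t in cubeSet c r, ENNReal.ofReal (matNorm (A t * M)) ^ s) := by
  set J := (ENNReal.ofReal (r ^ d))⁻¹ *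
    ∫⁻ t in cubeSet c r, ENNReal.ofReal (matNorm (A t * M)) ^ s with hJ
  have hterm (j : Fin n) :
      ENNReal.ofReal ‖mApp (V * M) (EuclideanSpace.single j 1)‖ ^ s ≤
        ENNReal.ofReal c₂ ^ s * J := by
    rw [mApp_mul]
    refine (ENNReal.rpow_le_rpow (hV _) hs.le).trans ?_
    rw [ENNReal.mul_rpow_of_nonneg _ _ hs.le, redAvgC_rpow hs, hJ]
    gcongr with t
    rw [← mApp_mul]
    exact norm_mApp_single_le _ _
  calc ENNReal.ofReal (matNorm (V * M)) ^ s
      ≤ (n : ℝ≥0∞) ^ s *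
          ∑ j, ENNReal.ofReal ‖mApp (V * M) (EuclideanSpace.single j 1)‖ ^ s :=
        ofReal_matNorm_rpow_le _ hs
    _ ≤ (n : ℝ≥0∞) ^ s * ∑ _j : Fin n, ENNReal.ofReal c₂ ^ s * J := by
        gcongr with j
        exact hterm j
    _ = _ := by
        simp only [Finset.sum_const, Finset.card_univ, Fintype.card_fin, nsmul_eq_mul]
        ring

end Averages

section Comparison

variable {d n : ℕ} {p c₁ c₂ : ℝ} {W : (Fin d → ℝ) → Matrix (Fin n) (Fin n) ℂ}
  {c : Fin d → ℝ} {r : ℝ} {V V' : Matrix (Fin n) (Fin n) ℂ}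

/-- The double average over a single cube whose supremum is `apNorm`. -/
def apAvg (p : ℝ) (W : (Fin d → ℝ) → Matrix (Fin n) (Fin n) ℂ) (c : Fin d → ℝ) (r : ℝ) :
    ℝ≥0∞ :=
  (ENNReal.ofReal (r ^ d))⁻¹ *
    ∫⁻ x in cubeSet c r,
      ((ENNReal.ofReal (r ^ d))⁻¹ *
          ∫⁻ t in cubeSet c r,
            ENNReal.ofReal (matNorm (W x * (W t)⁻¹)) ^ (p / (p - 1))) ^ (p - 1)

/-- By self-adjointness the inner factors in `apAvg` may be interchanged. -/
lemma lintegral_matNorm_mul_inv_comm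
    (hW : ∀ᵐ x ∂(volume : Measure (Fin d → ℝ)), (W x).PosDef) {x : Fin d → ℝ}
    (hx : (W x).PosDef) (q : ℝ) :
    ∫⁻ t in cubeSet c r, ENNReal.ofReal (matNorm (W x * (W t)⁻¹)) ^ q =
      ∫⁻ t in cubeSet c r, ENNReal.ofReal (matNorm ((W t)⁻¹ * W x)) ^ q := by
  refine lintegral_congr_ae ?_
  filter_upwards [ae_restrict_of_ae hW] with t ht
  rw [matNorm_mul_comm hx.isHermitian ht.isHermitian.inv]

lemma rpow_div_rpow_sub_one (hp : 1 < p) (a : ℝ≥0∞) : (a ^ (p / (p - 1))) ^ (p - 1) = a ^ p := by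
  rw [← ENNReal.rpow_mul, div_mul_cancel₀ _ (sub_pos.2 hp).ne']

lemma apAvg_le (hp : 1 < p) (hc₁ : 0 < c₁) (hWm : MatMeasurable W)
    (hW : ∀ᵐ x ∂(volume : Measure (Fin d → ℝ)), (W x).PosDef) (hV'p : V'.PosDef)
    (hV : ∀ e, ENNReal.ofReal c₁ * redAvgC p W c r e ≤ ENNReal.ofReal ‖mApp V e‖)
    (hV' : ∀ e, ENNReal.ofReal c₁ * redAvgC (p / (p - 1)) (fun x => (W x)⁻¹) c r e ≤
      ENNReal.ofReal ‖mApp V' e‖) :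
    apAvg p W c r ≤
      ((n : ℝ≥0∞) ^ (p / (p - 1)) * n * (ENNReal.ofReal c₁)⁻¹ ^ (p / (p - 1))) ^ (p - 1) *
        ((n : ℝ≥0∞) ^ p * n * (ENNReal.ofReal c₁)⁻¹ ^ p) *
          ENNReal.ofReal (matNorm (V * V')) ^ p := by
  have hp1 : 0 < p - 1 := sub_pos.2 hp
  have hp0 : 0 < p := by linarith
  set K := (n : ℝ≥0∞) ^ (p / (p - 1)) * n * (ENNReal.ofReal c₁)⁻¹ ^ (p / (p - 1)) with hK
  have hK_top : K ^ (p - 1) ≠ ⊤ := by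
    have : (ENNReal.ofReal c₁)⁻¹ ≠ ⊤ := by simpa using hc₁
    finiteness
  calc apAvg p W c r
      ≤ (ENNReal.ofReal (r ^ d))⁻¹ * ∫⁻ x in cubeSet c r,
          K ^ (p - 1) * ENNReal.ofReal (matNorm (W x * V')) ^ p := by
        refine mul_le_mul_right (lintegral_mono_ae ?_) _
        filter_upwards [ae_restrict_of_ae hW] with x hx
        rw [lintegral_matNorm_mul_inv_comm hW hx, matNorm_mul_comm hx.isHermitian
          hV'p.isHermitian, ← rpow_div_rpow_sub_one hp, ← ENNReal.mul_rpow_of_nonneg _ _ hp1.le]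
        exact ENNReal.rpow_le_rpow
          (average_matNorm_mul_rpow_le (by positivity) hc₁ hWm.inv hV' (W x)) hp1.le
    _ = K ^ (p - 1) * ((ENNReal.ofReal (r ^ d))⁻¹ * ∫⁻ x in cubeSet c r,
          ENNReal.ofReal (matNorm (W x * V')) ^ p) := by
        rw [lintegral_const_mul' _ _ hK_top, mul_left_comm]
    _ ≤ _ := by
        rw [mul_assoc]
        exact mul_le_mul_right (average_matNorm_mul_rpow_le hp0 hc₁ hWm hV V') _

lemma matNorm_mul_rpow_le_apAvg (hp : 1 < p)
    (hW : ∀ᵐ x ∂(volume : Measure (Fin d → ℝ)), (W x).PosDef) (hV'p : V'.PosDef)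
    (hV : ∀ e, ENNReal.ofReal ‖mApp V e‖ ≤ ENNReal.ofReal c₂ * redAvgC p W c r e)
    (hV' : ∀ e, ENNReal.ofReal ‖mApp V' e‖ ≤
      ENNReal.ofReal c₂ * redAvgC (p / (p - 1)) (fun x => (W x)⁻¹) c r e) :
    ENNReal.ofReal (matNorm (V * V')) ^ p ≤
      ((n : ℝ≥0∞) ^ p * n * ENNReal.ofReal c₂ ^ p) *
        ((n : ℝ≥0∞) ^ (p / (p - 1)) * n * ENNReal.ofReal c₂ ^ (p / (p - 1))) ^ (p - 1) *
          apAvg p W c r := by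
  have hp1 : 0 < p - 1 := sub_pos.2 hp
  have hp0 : 0 < p := by linarith
  set K := (n : ℝ≥0∞) ^ (p / (p - 1)) * n * ENNReal.ofReal c₂ ^ (p / (p - 1)) with hK
  have hK_top : K ^ (p - 1) ≠ ⊤ := by finiteness
  refine (matNorm_mul_rpow_le_average hp0 hV V').trans ?_
  rw [mul_assoc (_ * _ * _)]
  refine mul_le_mul_right ?_ _
  rw [apAvg, mul_left_comm, ← lintegral_const_mul' _ _ hK_top]
  refine mul_le_mul_right (lintegral_mono_ae ?_) _
  filter_upwards [ae_restrict_of_ae hW] with x hx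
  rw [lintegral_matNorm_mul_inv_comm hW hx, matNorm_mul_comm hx.isHermitian
    hV'p.isHermitian, ← rpow_div_rpow_sub_one hp, ← ENNReal.mul_rpow_of_nonneg _ _ hp1.le]
  exact ENNReal.rpow_le_rpow (matNorm_mul_rpow_le_average (by positivity) hV' (W x)) hp1.le

end Comparison

/-- For `1 < p < ∞` and a matrix weight `W` on `ℝ^d` with reducing
operators `V_I` and dual reducing operators `V_I'` (over all cubes), the quantity
`sup_I (1/|I|)∫_I ((1/|I|)∫_I ‖W^{1/p}(x) W^{-1/p}(t)‖^{p'} dt)^{p/p'} dx` is finite iff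
`sup_I ‖V_I V_I'‖` is finite, and it is comparable to `(sup_I ‖V_I V_I'‖)^p` with
constants depending only on `p, n` (and the comparability constants `c₁, c₂`). -/
theorem statement18 (d n : ℕ) (hd : 0 < d) (hn : 0 < n) (p c₁ c₂ : ℝ)
    (hp : 1 < p) (hc₁ : 0 < c₁) (hc₂ : 0 < c₂) :
    ∃ A B : ℝ≥0∞, 0 < A ∧ A < ⊤ ∧ 0 < B ∧ B < ⊤ ∧
      ∀ (W1p : (Fin d → ℝ) → Matrix (Fin n) (Fin n) ℂ)
        (V V' : (Fin d → ℝ) → ℝ → Matrix (Fin n) (Fin n) ℂ),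
        MatMeasurable W1p →
        (∀ᵐ x ∂(volume : Measure (Fin d → ℝ)), (W1p x).PosDef) →
        IsReducingAll p c₁ c₂ W1p V →
        IsDualReducingAll p c₁ c₂ W1p V' →
        (apNorm p W1p < ⊤ ↔
            (⨆ (c : Fin d → ℝ) (r : ℝ) (_ : 0 < r),
              ENNReal.ofReal (matNorm (V c r * V' c r))) < ⊤) ∧
          A * (⨆ (c : Fin d → ℝ) (r : ℝ) (_ : 0 < r),
                ENNReal.ofReal (matNorm (V c r * V' c r))) ^ p ≤ apNorm p W1p ∧
          apNorm p W1p ≤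
            B * (⨆ (c : Fin d → ℝ) (r : ℝ) (_ : 0 < r),
                  ENNReal.ofReal (matNorm (V c r * V' c r))) ^ p := by
  set B : ℝ≥0∞ :=
    ((n : ℝ≥0∞) ^ (p / (p - 1)) * n * (ENNReal.ofReal c₁)⁻¹ ^ (p / (p - 1))) ^ (p - 1) *
      ((n : ℝ≥0∞) ^ p * n * (ENNReal.ofReal c₁)⁻¹ ^ p) with hB
  set K : ℝ≥0∞ := ((n : ℝ≥0∞) ^ p * n * ENNReal.ofReal c₂ ^ p) *
    ((n : ℝ≥0∞) ^ (p / (p - 1)) * n * ENNReal.ofReal c₂ ^ (p / (p - 1))) ^ (p - 1) with hK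
  have hp1 : 0 < p - 1 := sub_pos.2 hp
  have hp0 : 0 < p := by linarith
  have hn0 : (n : ℝ≥0∞) ≠ 0 := by exact_mod_cast hn.ne'
  have hc₁_inv : (ENNReal.ofReal c₁)⁻¹ ≠ ⊤ := by simpa using hc₁
  have hB0 : 0 < B := by
    rw [hB, pos_iff_ne_zero]
    simp [ENNReal.rpow_eq_zero_iff, hn0, hp1.not_gt, hp0.not_gt, div_pos hp0 hp1 |>.not_gt]
  have hB_top : B < ⊤ := by
    have h0 : 0 ≤ p / (p - 1) := by positivity
    rw [hB]
    finiteness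
  have hK0 : K ≠ 0 := by
    simp [hK, ENNReal.rpow_eq_zero_iff, hn0, hp1.not_gt, hp0.not_gt, hc₂.not_ge]
  have hK_top : K ≠ ⊤ := by
    have h0 : 0 ≤ p / (p - 1) := by positivity
    rw [hK]
    finiteness
  refine ⟨K⁻¹, B, ENNReal.inv_pos.2 hK_top, ENNReal.inv_lt_top.2 (pos_iff_ne_zero.2 hK0), hB0,
    hB_top, fun W V V' hWm hW hV hV' => ?_⟩
  set S := ⨆ (c : Fin d → ℝ) (r : ℝ) (_ : 0 < r), ENNReal.ofReal (matNorm (V c r * V' c r))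
    with hS
  have hap : apNorm p W = ⨆ (c : Fin d → ℝ) (r : ℝ) (_ : 0 < r), apAvg p W c r := rfl
  have hupper : apNorm p W ≤ B * S ^ p := by
    rw [hap]
    refine iSup_le fun c => iSup_le fun r => iSup_le fun hr => ?_
    refine (apAvg_le hp hc₁ hWm hW (hV' c r hr).1 (fun e => ((hV c r hr).2 e).1)
      fun e => ((hV' c r hr).2 e).1).trans ?_
    refine mul_le_mul_right (ENNReal.rpow_le_rpow ?_ hp0.le) _
    exact le_iSup_of_le c (le_iSup_of_le r (le_iSup_of_le hr le_rfl))
  have hlower : S ^ p ≤ K * apNorm p W := by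
    rw [← ENNReal.le_rpow_inv_iff hp0]
    refine iSup_le fun c => iSup_le fun r => iSup_le fun hr => ?_
    rw [ENNReal.le_rpow_inv_iff hp0]
    refine (matNorm_mul_rpow_le_apAvg hp hW (hV' c r hr).1 (fun e => ((hV c r hr).2 e).2)
      fun e => ((hV' c r hr).2 e).2).trans ?_
    refine mul_le_mul_right ?_ _
    rw [hap]
    exact le_iSup_of_le c (le_iSup_of_le r (le_iSup_of_le hr le_rfl))
  refine ⟨⟨fun h => ?_, fun h => ?_⟩, ?_, hupper⟩
  · exact (ENNReal.rpow_lt_top_iff_of_pos hp0).1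
      (hlower.trans_lt (ENNReal.mul_lt_top hK_top.lt_top h))
  · exact hupper.trans_lt
      (ENNReal.mul_lt_top hB_top ((ENNReal.rpow_lt_top_iff_of_pos hp0).2 h))
  · rwa [ENNReal.inv_mul_le_iff hK0 hK_top]

end
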